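/- Assume d = 1, μ has finite second moment, σ is X-controlled, and σ has constant drift equal to 1: ∫_G σ(g,x) dμ(g) = 1 for every x ∈ X. Then for every ε > 0 there exists R > 0 such that for every x ∈ X and every s > 1, β{b ∈ B : |τ_s(b,x) − s| > R√s} ≤ ε. -/

import Mathlib

open MeasureTheory Filter Topology
open scoped ENNReal NNReal

noncomputable section

/-- The group element `b_n ⋯ b_1`, where `b_i` is coordinate `i - 1` of `b`. -/
def prodRev {G : Type*} [Monoid G] (b : ℕ → G) : ℕ → G
  | 0 => 1
  | n + 1 => b n * prodRev b n

/-- The `n`-th convolution power of `μ`: the law of `b_n ⋯ b_1` for i.i.d. `b_i` of law `μ`. -/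
def convPow {G : Type*} [Monoid G] [MeasurableSpace G] (μ : Measure G) : ℕ → Measure G
  | 0 => Measure.dirac 1
  | n + 1 => (μ.prod (convPow μ n)).map fun p => p.1 * p.2

/-- The σ-algebra on `ℕ → G` generated by the first `k` coordinates. -/
def coordSA (G : Type*) [MeasurableSpace G] (k : ℕ) : MeasurableSpace (ℕ → G) :=
  MeasurableSpace.comap (fun b (i : Fin k) => b i) MeasurableSpace.pi

/-- The exit time `τ_s(b, x) = inf {n ≥ 1 : σ(b_n ⋯ b_1, x) ≥ s}`. -/
def exitTime {G : Type*} [Monoid G] {X : Type*} (σ : G → X → ℝ) (s : ℝ)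
    (b : ℕ → G) (x : X) : ℕ :=
  sInf {n : ℕ | 1 ≤ n ∧ s ≤ σ (prodRev b n) x}

/-- One step of the stopped, recentred chain. -/
def stepQ {G X : Type*} [Group G] [MulAction G X] (σ : G → X → ℝ) (l : ℝ) (z : X × ℝ) (g : G) :
    X × ℝ :=
  (g • z.1, if l ≤ |z.2| then z.2 else z.2 + (σ g z.1 - 1))

/-- The stopped, recentred chain as a function of the first `n` increments. -/
def chainQ {G X : Type*} [Group G] [MulAction G X] (σ : G → X → ℝ) (l : ℝ) (x : X) :
    (n : ℕ) → (Fin n → G) → X × ℝ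
  | 0, _ => (x, 0)
  | n + 1, c => stepQ σ l (chainQ σ l x n (fun i => c i.castSucc)) (c (Fin.last n))

theorem measurable_stepQ {G X : Type*} [Group G] [MeasurableSpace G] [MeasurableSpace X]
    [MulAction G X] (hact : Measurable fun p : G × X => p.1 • p.2) (σ : G → X → ℝ)
    (hσmeas : Measurable fun p : G × X => σ p.1 p.2) (l : ℝ) :
    Measurable fun p : (X × ℝ) × G => stepQ σ l p.1 p.2 := by
  unfold stepQ
  have h1 : Measurable fun p : (X × ℝ) × G => (p.2, p.1.1) := by fun_prop
  have h2 : Measurable fun p : (X × ℝ) × G => p.1.2 := by fun_prop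
  refine (hact.comp h1).prodMk (Measurable.ite ?_ h2 (h2.add ((hσmeas.comp h1).sub_const 1)))
  exact measurableSet_le measurable_const (measurable_norm.comp h2)

theorem measurable_chainQ {G X : Type*} [Group G] [MeasurableSpace G] [MeasurableSpace X]
    [MulAction G X] (hact : Measurable fun p : G × X => p.1 • p.2) (σ : G → X → ℝ)
    (hσmeas : Measurable fun p : G × X => σ p.1 p.2) (l : ℝ) (x : X) (n : ℕ) :
    Measurable (chainQ σ l x n) := by
  induction n with
  | zero => exact measurable_const
  | succ n ih =>
    have h : Measurable fun c : Fin (n+1) → G =>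
        (chainQ σ l x n (fun i => c i.castSucc), c (Fin.last n)) := by
      refine (ih.comp ?_).prodMk (measurable_pi_apply _)
      exact measurable_pi_lambda _ fun i => measurable_pi_apply _
    exact (measurable_stepQ hact σ hσmeas l).comp h

theorem chainQ_prop {G X : Type*} [Group G] [MulAction G X] (σ : G → X → ℝ)
    (hcoc : ∀ g₁ g₂ : G, ∀ x : X, σ (g₂ * g₁) x = σ g₂ (g₁ • x) + σ g₁ x)
    (l : ℝ) (x : X) (b : ℕ → G) (n : ℕ) :
    (chainQ σ l x n (fun i => b i)).1 = prodRev b n • x ∧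
    (l ≤ |(chainQ σ l x n (fun i => b i)).2| ∨
      ((chainQ σ l x n (fun i => b i)).2 = σ (prodRev b n) x - n ∧
        ∀ k ≤ n, |σ (prodRev b k) x - k| < l)) := by
  have h1 : σ 1 x = 0 := by
    have := hcoc 1 1 x
    simp at this
    exact this
  induction n with
  | zero =>
    simp only [chainQ, prodRev, one_smul, true_and, h1]
    by_cases hl : l ≤ 0
    · left; simpa using hl
    · right
      refine ⟨by simp, fun k hk => ?_⟩
      obtain rfl : k = 0 := by omega
      simpa [prodRev, h1] using hl
  | succ n ih =>
    have e : chainQ σ l x (n+1) (fun i => b i)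
        = stepQ σ l (chainQ σ l x n (fun i => b i)) (b n) := rfl
    rw [e]
    generalize chainQ σ l x n (fun i => b i) = z at ih
    obtain ⟨hy, ht⟩ := ih
    refine ⟨by simp [stepQ, hy, prodRev, mul_smul], ?_⟩
    by_cases hl : l ≤ |z.2|
    · left; simp [stepQ, hl]
    · obtain ⟨h2, h3⟩ := ht.resolve_left hl
      have e2 : (stepQ σ l z (b n)).2 = σ (prodRev b (n+1)) x - (n+1 : ℕ) := by
        simp only [stepQ, hl, if_false, prodRev, hcoc, hy]
        rw [h2]
        push_cast; ring
      rw [e2]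
      by_cases h4 : l ≤ |σ (prodRev b (n+1)) x - (n+1 : ℕ)|
      · exact Or.inl h4
      · refine Or.inr ⟨rfl, fun k hk => ?_⟩
        rcases Nat.lt_or_ge n k with h | h
        · obtain rfl : k = n+1 := by omega
          exact not_le.1 h4
        · exact h3 k h

theorem step_bound {G X : Type*} [Group G] [MeasurableSpace G] [MeasurableSpace X]
    [MulAction G X] (σ : G → X → ℝ)
    (hσmeas : Measurable fun p : G × X => σ p.1 p.2)
    (N : G → ℝ) (hN0 : ∀ g, 0 ≤ N g) (hNσ : ∀ g x, |σ g x| ≤ N g)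
    (μ : Measure G) [IsProbabilityMeasure μ]
    (hmom1 : Integrable N μ) (hmom2 : Integrable (fun g => N g ^ 2) μ)
    (hdrift : ∀ x, ∫ g, σ g x ∂μ = 1) (l : ℝ) (z : X × ℝ) :
    ∫⁻ g, ENNReal.ofReal ((stepQ σ l z g).2 ^ 2) ∂μ ≤
      ENNReal.ofReal (z.2 ^ 2) + ENNReal.ofReal (∫ g, (N g + 1) ^ 2 ∂μ) := by
  by_cases hl : l ≤ |z.2|
  · simp [stepQ, hl]
  have hm : Measurable fun g => σ g z.1 := hσmeas.comp (measurable_id.prodMk measurable_const)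
  have hi1 : Integrable (fun g => σ g z.1) μ :=
    hmom1.mono' hm.aestronglyMeasurable (ae_of_all _ fun g => hNσ g z.1)
  have hiN : Integrable (fun g => (N g + 1) ^ 2) μ := by
    have : (fun g => (N g + 1) ^ 2) = fun g => N g ^ 2 + 2 * N g + 1 := by ext; ring
    rw [this]
    exact (hmom2.add (hmom1.const_mul 2)).add (integrable_const 1)
  have hle : ∀ g, (σ g z.1 - 1) ^ 2 ≤ (N g + 1) ^ 2 := fun g => by
    have h := abs_le.1 (hNσ g z.1)
    exact sq_le_sq' (by linarith) (by linarith)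
  have hi2 : Integrable (fun g => (σ g z.1 - 1) ^ 2) μ :=
    hiN.mono' ((hm.sub_const 1).pow_const 2).aestronglyMeasurable
      (ae_of_all _ fun g => by
        rw [Real.norm_of_nonneg (sq_nonneg _)]; exact hle g)
  have hi3 : Integrable (fun g => 2 * z.2 * (σ g z.1 - 1)) μ :=
    (hi1.sub (integrable_const 1)).const_mul _
  have e : ∀ g, (stepQ σ l z g).2 ^ 2
      = z.2 ^ 2 + 2 * z.2 * (σ g z.1 - 1) + (σ g z.1 - 1) ^ 2 := fun g => by
    simp only [stepQ, hl, if_false]; ring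
  simp_rw [e]
  have hi4 : Integrable (fun g => z.2 ^ 2 + 2 * z.2 * (σ g z.1 - 1)) μ :=
    (integrable_const _).add hi3
  have hi5 : Integrable (fun g => z.2 ^ 2 + 2 * z.2 * (σ g z.1 - 1) + (σ g z.1 - 1) ^ 2) μ :=
    hi4.add hi2
  rw [← ofReal_integral_eq_lintegral_ofReal hi5
    (ae_of_all _ fun g => by
      have := e g
      show 0 ≤ z.2 ^ 2 + 2 * z.2 * (σ g z.1 - 1) + (σ g z.1 - 1) ^ 2
      rw [← this]; positivity)]
  rw [← ENNReal.ofReal_add (sq_nonneg _) (integral_nonneg fun g => sq_nonneg _)]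
  apply ENNReal.ofReal_le_ofReal
  have e5 : ∫ g, (z.2 ^ 2 + 2 * z.2 * (σ g z.1 - 1) + (σ g z.1 - 1) ^ 2) ∂μ
      = z.2 ^ 2 + ∫ g, (σ g z.1 - 1) ^ 2 ∂μ := by
    rw [integral_add hi4 hi2, integral_add (integrable_const _) hi3, integral_const_mul,
      integral_sub hi1 (integrable_const _), hdrift]
    simp
  refine e5.le.trans ?_
  exact add_le_add le_rfl (integral_mono hi2 hiN hle)

theorem chain_bound {G X : Type*} [Group G] [MeasurableSpace G] [MeasurableSpace X]
    [MulAction G X] (hact : Measurable fun p : G × X => p.1 • p.2) (σ : G → X → ℝ)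
    (hσmeas : Measurable fun p : G × X => σ p.1 p.2)
    (μ : Measure G) [IsProbabilityMeasure μ] (l : ℝ) (C : ℝ≥0∞)
    (hstep : ∀ z : X × ℝ, ∫⁻ g, ENNReal.ofReal ((stepQ σ l z g).2 ^ 2) ∂μ ≤
      ENNReal.ofReal (z.2 ^ 2) + C) (x : X) (n : ℕ) :
    ∫⁻ c, ENNReal.ofReal ((chainQ σ l x n c).2 ^ 2) ∂(Measure.pi fun _ : Fin n => μ) ≤ n * C := by
  induction n with
  | zero => simp [chainQ]
  | succ n ih =>
    have hmp := measurePreserving_piFinSuccAbove (fun _ : Fin (n+1) => μ) (Fin.last n)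
    have hF : Measurable fun p : G × (Fin n → G) =>
        ENNReal.ofReal ((stepQ σ l (chainQ σ l x n p.2) p.1).2 ^ 2) := by
      have hz : Measurable fun p : G × (Fin n → G) => stepQ σ l (chainQ σ l x n p.2) p.1 :=
        (measurable_stepQ hact σ hσmeas l).comp
          (((measurable_chainQ hact σ hσmeas l x n).comp measurable_snd).prodMk measurable_fst)
      exact ENNReal.measurable_ofReal.comp (Measurable.pow_const (measurable_snd.comp hz) 2)
    have h := hmp.lintegral_comp hF
    have e : ∀ c : Fin (n+1) → G, chainQ σ l x (n+1) c = stepQ σ l (chainQ σ l x n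
        ((MeasurableEquiv.piFinSuccAbove (fun _ => G) (Fin.last n) c).2))
        ((MeasurableEquiv.piFinSuccAbove (fun _ => G) (Fin.last n) c).1) := by
      intro c
      have : (MeasurableEquiv.piFinSuccAbove (fun _ => G) (Fin.last n) c).2
          = fun i : Fin n => c i.castSucc := by
        ext i
        simp [MeasurableEquiv.piFinSuccAbove, Fin.insertNthEquiv, Fin.removeNth, Fin.init]
      rw [this]
      rfl
    simp_rw [e]
    rw [h, lintegral_prod_symm _ hF.aemeasurable]
    calc _ ≤ ∫⁻ c, (ENNReal.ofReal ((chainQ σ l x n c).2 ^ 2) + C)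
            ∂(Measure.pi fun _ : Fin n => μ) := lintegral_mono fun c => hstep _
      _ = ∫⁻ c, ENNReal.ofReal ((chainQ σ l x n c).2 ^ 2) ∂(Measure.pi fun _ : Fin n => μ) + C := by
          rw [lintegral_add_right _ measurable_const]; simp
      _ ≤ n * C + C := by gcongr
      _ = _ := by push_cast; ring

/-- the exit time lands in a window of size sqrt s around s. -/
theorem exit_time_control
    {G : Type*} [Group G] [MeasurableSpace G] [MeasurableMul₂ G]
    {X : Type*} [MetricSpace X] [CompactSpace X] [MeasurableSpace X] [BorelSpace X]
    [MulAction G X] (hact : Measurable fun p : G × X => p.1 • p.2)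
    (σ : G → X → ℝ)
    (hσmeas : Measurable fun p : G × X => σ p.1 p.2)
    (hcoc : ∀ g₁ g₂ : G, ∀ x : X, σ (g₂ * g₁) x = σ g₂ (g₁ • x) + σ g₁ x)
    (N : G → ℝ) (hN0 : ∀ g, 0 ≤ N g) (hNsub : ∀ g h : G, N (g * h) ≤ N g + N h)
    (hNσ : ∀ g x, |σ g x| ≤ N g)
    (μ : Measure G) [IsProbabilityMeasure μ]
    (hmom1 : Integrable N μ)
    (hmom2 : Integrable (fun g => N g ^ 2) μ)
    (hcont : ∀ g, Continuous (σ g))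
    (hXctrl : ∀ ε > (0 : ℝ), ∃ R > (0 : ℝ), ∀ n : ℕ, 1 ≤ n → ∀ x y : X,
      ENNReal.ofReal (1 - ε) ≤ convPow μ n {g | |σ g x - σ g y| ≤ R})
    (hdrift : ∀ x, ∫ g, σ g x ∂μ = 1)
    (β : Measure (ℕ → G)) [IsProbabilityMeasure β]
    (hβ : ∀ n : ℕ, β.map (fun b (i : Fin n) => b i) = Measure.pi fun _ : Fin n => μ) :
    ∀ ε > (0 : ℝ), ∃ R > (0 : ℝ), ∀ x : X, ∀ s : ℝ, 1 < s →
      β {b | R * Real.sqrt s < |(exitTime σ s b x : ℝ) - s|} ≤ ENNReal.ofReal ε := by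
  intro ε hε
  set C := ∫ g, (N g + 1) ^ 2 ∂μ with hC
  have hC0 : 0 ≤ C := integral_nonneg fun g => sq_nonneg _
  set R := 3 + 2 * C / ε with hR
  have hR3 : 3 ≤ R := by
    have : 0 ≤ 2 * C / ε := by positivity
    linarith
  refine ⟨R, by linarith, fun x s hs => ?_⟩
  have hq1 : 1 < Real.sqrt s := by
    rw [Real.lt_sqrt] <;> linarith
  have hqs : Real.sqrt s ^ 2 = s := Real.sq_sqrt (by linarith)
  set q := Real.sqrt s with hq
  set l := R * q - 1 with hl
  set n := ⌊s + R * q⌋₊ with hn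
  have hRq : 3 < R * q := by nlinarith
  have hn1 : (n : ℝ) ≤ s + R * q := Nat.floor_le (by linarith)
  have hn2 : s + R * q < n + 1 := Nat.lt_floor_add_one _
  have hnpos : 1 ≤ n := by
    have : (1 : ℝ) < n := by linarith
    exact_mod_cast this.le
  have hl0 : 0 < l := by linarith
  have hmQ := measurable_chainQ hact σ hσmeas l x n
  have hsub : {b | R * q < |(exitTime σ s b x : ℝ) - s|} ⊆
      (fun (b : ℕ → G) (i : Fin n) => b i) ⁻¹' {c | l ≤ |(chainQ σ l x n c).2|} := by
    intro b hb
    simp only [Set.mem_setOf_eq, Set.mem_preimage] at hb ⊢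
    rcases (chainQ_prop σ hcoc l x b n).2 with h | ⟨-, h⟩
    · exact h
    exfalso
    have hSn : s ≤ σ (prodRev b n) x := by
      have := abs_lt.1 (h n le_rfl)
      linarith
    have hmem : n ∈ {n : ℕ | 1 ≤ n ∧ s ≤ σ (prodRev b n) x} := ⟨hnpos, hSn⟩
    have hτ : exitTime σ s b x ≤ n := Nat.sInf_le hmem
    have hτm : exitTime σ s b x ∈ {n : ℕ | 1 ≤ n ∧ s ≤ σ (prodRev b n) x} :=
      Nat.sInf_mem ⟨n, hmem⟩
    have h5 := abs_lt.1 (h _ hτ)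
    have h6 := hτm.2
    have h7 : (exitTime σ s b x : ℝ) ≤ n := by exact_mod_cast hτ
    rcases lt_abs.1 hb with h8 | h8 <;> linarith
  have hmeas : MeasurableSet {c | l ≤ |(chainQ σ l x n c).2|} :=
    measurableSet_le measurable_const (measurable_norm.comp (measurable_snd.comp hmQ))
  have hrm : Measurable (fun (b : ℕ → G) (i : Fin n) => b i) :=
    measurable_pi_lambda _ fun i => measurable_pi_apply _
  refine (measure_mono hsub).trans ?_
  rw [← Measure.map_apply hrm hmeas, hβ n]
  have hb := chain_bound hact σ hσmeas μ l (ENNReal.ofReal C)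
    (step_bound σ hσmeas N hN0 hNσ μ hmom1 hmom2 hdrift l) x n
  have hmk := mul_meas_ge_le_lintegral₀ (μ := Measure.pi fun _ : Fin n => μ)
    (f := fun c => ENNReal.ofReal ((chainQ σ l x n c).2 ^ 2))
    (ENNReal.measurable_ofReal.comp ((measurable_snd.comp hmQ).pow_const 2)).aemeasurable
    (ENNReal.ofReal (l ^ 2))
  have hsub2 : {c | l ≤ |(chainQ σ l x n c).2|} ⊆
      {c | ENNReal.ofReal (l ^ 2) ≤ ENNReal.ofReal ((chainQ σ l x n c).2 ^ 2)} := by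
    intro c hc
    apply ENNReal.ofReal_le_ofReal
    have hc' : l ≤ |(chainQ σ l x n c).2| := hc
    rw [← sq_abs (chainQ σ l x n c).2]
    gcongr
  refine (measure_mono hsub2).trans ?_
  have hl2 : 0 < l ^ 2 := by positivity
  have key : (n : ℝ) * C ≤ l ^ 2 * ε := by
    have hCe : 2 * C = (R - 3) * ε := by rw [hR]; field_simp; ring
    have a1 : (R - 1) * q ≤ l := by rw [hl]; linarith
    have a2 : ((R - 1) * q) ^ 2 ≤ l ^ 2 := by
      have : 0 ≤ (R - 1) * q := mul_nonneg (by linarith) (by linarith)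
      gcongr
    have a3 : (n : ℝ) ≤ (1 + R) * q ^ 2 := by nlinarith
    calc (n : ℝ) * C ≤ (1 + R) * q ^ 2 * C := by gcongr
      _ = ((1 + R) * (R - 3) / 2) * (q ^ 2 * ε) := by
          rw [show C = (R - 3) * ε / 2 by linarith]; ring
      _ ≤ (R - 1) ^ 2 * (q ^ 2 * ε) := by
          have : 0 ≤ q ^ 2 * ε := by positivity
          gcongr
          nlinarith
      _ = ((R - 1) * q) ^ 2 * ε := by ring
      _ ≤ l ^ 2 * ε := by gcongr
  have h9 := hmk.trans hb
  have h10 : (n : ℝ≥0∞) * ENNReal.ofReal C ≤ ENNReal.ofReal (l ^ 2) * ENNReal.ofReal ε := by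
    rw [← ENNReal.ofReal_natCast, ← ENNReal.ofReal_mul (by positivity),
      ← ENNReal.ofReal_mul (by positivity)]
    exact ENNReal.ofReal_le_ofReal key
  exact (ENNReal.mul_le_mul_iff_right (by simpa using hl0.ne') ENNReal.ofReal_ne_top).1 (h9.trans h10)
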